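/- Let R ≥ 4 be an integer, let q' be a prime power with q' ≥ 3, and let q = (q')^R. Set n_1 = (q' − 1)·(R(R+1)/2 − 2) + R + 5. Then for every integer t ≥ 1 such that either t = 1 or q^{t−1} ≥ n_1, there exists w ∈ {0,1} (with w = 0 whenever q' ≥ 4) such that there exists a linear [n, n−(Rt+1)]_q code with covering radius R, where n = n_1·q^{t−1} + w·(q^{t−1} − 1)/(q − 1). -/

import Mathlib

noncomputable section

/-- `S` is a `ρ`-saturating set of points of the projective space `PG(m-1, F)`
(projectivization of `F^m`): every point lies in the projective subspace generated by
some `ρ+1` points of `S`. -/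
def IsSaturating (F : Type*) [Field F] (m ρ : ℕ)
    (S : Set (Projectivization F (Fin m → F))) : Prop :=
  ∀ P : Projectivization F (Fin m → F),
    ∃ p : Fin (ρ + 1) → Projectivization F (Fin m → F),
      (∀ i, p i ∈ S) ∧
        P.rep ∈ Submodule.span F (Set.range (fun i => (p i).rep))

/-- `B` is a `t`-fold strong blocking set of `PG(m-1, F)`: every `t`-dimensional
linear subspace of `F^m` (i.e. every `(t-1)`-dimensional projective subspace)
is the span of `t` points of `B`. -/
def IsStrongBlocking (F : Type*) [Field F] (m t : ℕ)
    (B : Set (Projectivization F (Fin m → F))) : Prop :=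
  ∀ W : Submodule F (Fin m → F), Module.finrank F W = t →
    ∃ p : Fin t → Projectivization F (Fin m → F),
      (∀ i, p i ∈ B) ∧
        Submodule.span F (Set.range (fun i => (p i).rep)) = W

/-- `B` is a `t`-fold blocking set of `PG(m-1, F)`:
every line meets `B` in at least `t` points. -/
def IsBlocking (F : Type*) [Field F] (m t : ℕ)
    (B : Set (Projectivization F (Fin m → F))) : Prop :=
  ∀ W : Submodule F (Fin m → F), Module.finrank F W = 2 →
    t ≤ {P | P ∈ B ∧ P.rep ∈ W}.ncard

/-- The embedding of the subgeometry `PG(m-1, K)` into `PG(m-1, L)`, induced by applying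
the inclusion `K ↪ L` coordinatewise to representative vectors. -/
def subgeom {m : ℕ} (K L : Type*) [Field K] [Field L] [Algebra K L]
    (P : Projectivization K (Fin m → K)) : Projectivization L (Fin m → L) :=
  Projectivization.mk L (fun i => algebraMap K L (P.rep i))
    (by
      intro h
      apply P.rep_nonzero
      funext i
      have hi : algebraMap K L (P.rep i) = 0 := congrFun h i
      exact (algebraMap K L).injective (by simpa using hi))

/-- The linear code `C` has covering radius exactly `R`: every vector is within Hamming
distance `R` of a codeword, and `R` is the least such value. -/
def IsCovRadius {F : Type*} [Field F] [DecidableEq F] {n : ℕ}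
    (C : Submodule F (Fin n → F)) (R : ℕ) : Prop :=
  (∀ x : Fin n → F, ∃ c ∈ C, hammingDist x c ≤ R) ∧
  (∃ x : Fin n → F, ∀ c ∈ C, R ≤ hammingDist x c)

/-- There exists a linear `[n, n-r]` code over `F` with covering radius `R`. -/
def ExistsCovCode (F : Type*) [Field F] [DecidableEq F] (n r R : ℕ) : Prop :=
  r ≤ n ∧ ∃ C : Submodule F (Fin n → F),
    Module.finrank F C = n - r ∧ IsCovRadius C R

/-- `V_q(n,R)`: the cardinality of a Hamming sphere of radius `R` in `F_q^n`. -/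
def sphereCard (q n R : ℕ) : ℕ :=
  ∑ i ∈ Finset.range (R + 1), (q - 1) ^ i * n.choose i

/-- Two indices are adjacent with respect to a family of vectors when they lie on a common
line with a third index, any two of the three vectors being able to express the remaining one
with nonzero coefficients. -/
def CollinearAdj (F : Type*) {U ι : Type*} [Field F] [AddCommGroup U] [Module F U]
    (h : ι → U) (i j : ι) : Prop :=
  ∃ k, i ≠ j ∧ i ≠ k ∧ j ≠ k ∧
    ∃ a b c : F, a ≠ 0 ∧ b ≠ 0 ∧ c ≠ 0 ∧ a • h i + b • h j + c • h k = 0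

/-- A predicate on indices that does not distinguish collinearly adjacent indices. -/
def CollinearInvariant (F : Type*) {U ι : Type*} [Field F] [AddCommGroup U] [Module F U]
    (h : ι → U) (P : ι → Prop) : Prop :=
  ∀ i j, CollinearAdj F h i j → (P i ↔ P j)

/-- Every hyperplane is spanned by at most `m - 1` of the vectors `h i`. -/
def SpansHyperplanes (F : Type*) {U ι : Type*} [Field F] [AddCommGroup U] [Module F U]
    (m : ℕ) (h : ι → U) : Prop :=
  ∀ f : U →ₗ[F] F, f ≠ 0 → ∃ J : Finset ι, J.card + 1 ≤ m ∧
    LinearMap.ker f ≤ Submodule.span F (h '' J)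

section Transport

variable {F U V ι κ : Type*} [Field F] [AddCommGroup U] [Module F U] [AddCommGroup V] [Module F V]

theorem CollinearAdj.map {h : ι → U} {g : κ → V} (φ : U →ₗ[F] V) (e : ι ↪ κ)
    (hg : ∀ i, g (e i) = φ (h i)) {i j : ι} (hij : CollinearAdj F h i j) :
    CollinearAdj F g (e i) (e j) := by
  obtain ⟨k, h1, h2, h3, a, b, c, ha, hb, hc, habc⟩ := hij
  refine ⟨e k, by simpa, by simpa, by simpa, a, b, c, ha, hb, hc, ?_⟩
  simp only [hg, ← map_smul, ← map_add, habc, map_zero]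

theorem CollinearInvariant.comp {h : ι → U} {g : κ → V} (φ : U →ₗ[F] V) (e : ι ↪ κ)
    (hg : ∀ i, g (e i) = φ (h i)) {P : κ → Prop} (hP : CollinearInvariant F g P) :
    CollinearInvariant F h (fun i => P (e i)) :=
  fun _ _ hij => hP _ _ (hij.map φ e hg)

theorem SpansHyperplanes.map_equiv {m : ℕ} {h : ι → U} (hh : SpansHyperplanes F m h)
    (φ : U ≃ₗ[F] V) : SpansHyperplanes F m (φ ∘ h) := by
  intro f hf
  obtain ⟨J, hJ, hker⟩ := hh (f ∘ₗ φ.toLinearMap) (by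
    intro h0
    apply hf
    ext x
    simpa using LinearMap.congr_fun h0 (φ.symm x))
  refine ⟨J, hJ, fun x hx => ?_⟩
  have h1 : φ.symm x ∈ Submodule.span F (h '' J) := hker (by simpa using hx)
  have h2 := Submodule.mem_map_of_mem (f := φ.toLinearMap) h1
  rw [Submodule.map_span] at h2
  simpa [Set.image_image] using h2

theorem span_range_linearEquiv {h : ι → U} {p : κ → ι} (φ : U ≃ₗ[F] V)
    (hp : Submodule.span F (Set.range (h ∘ p)) = ⊤) :
    Submodule.span F (Set.range ((φ ∘ h) ∘ p)) = ⊤ := by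
  rw [Function.comp_assoc, Set.range_comp]
  change Submodule.span F (φ.toLinearMap '' _) = ⊤
  rw [← Submodule.map_span, hp, Submodule.map_top, LinearEquiv.range]

end Transport

/-- The index set of a cone over a configuration: the old points, the vertex, and the remaining
points of the lines joining the vertex to the chosen base points. -/
abbrev ConeIndex (F ι : Type*) [Field F] (m : ℕ) := ι ⊕ Unit ⊕ (Fin m × Fˣ)

/-- The vectors of the cone over the configuration `h` with base points `p`. -/
def coneVec {F U ι : Type*} [Field F] [AddCommGroup U] [Module F U] {m : ℕ}
    (h : ι → U) (p : Fin m → ι) : ConeIndex F ι m → U × F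
  | .inl i => (h i, 0)
  | .inr (.inl _) => (0, 1)
  | .inr (.inr (k, a)) => (h (p k), (a : F))

/-- The base points of the cone: the old base points and the vertex. -/
def conePts {F ι : Type*} [Field F] {m : ℕ} (p : Fin m → ι) : Fin (m + 1) → ConeIndex F ι m :=
  Fin.cons (.inr (.inl ())) (fun k => .inl (p k))

section Cone

variable {F U ι : Type*} [Field F] [AddCommGroup U] [Module F U] {m : ℕ}
  {h : ι → U} {p : Fin m → ι}

theorem span_conePts (hp : Submodule.span F (Set.range (h ∘ p)) = ⊤) :
    Submodule.span F (Set.range (coneVec (F := F) h p ∘ conePts p)) = ⊤ := by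
  rw [eq_top_iff]
  rintro ⟨u, a⟩ -
  have hu : u ∈ Submodule.span F (Set.range (h ∘ p)) := by simp [hp]
  have h1 := Submodule.mem_map_of_mem (f := LinearMap.inl F U F) hu
  rw [Submodule.map_span] at h1
  have e : ((u, a) : U × F) = LinearMap.inl F U F u + a • ((0, 1) : U × F) := by simp
  rw [e]
  refine Submodule.add_mem _ (Submodule.span_mono ?_ h1) (Submodule.smul_mem _ _
    (Submodule.subset_span ⟨0, rfl⟩))
  rintro _ ⟨_, ⟨k, rfl⟩, rfl⟩
  exact ⟨k.succ, rfl⟩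

theorem collinearInvariant_coneVec
    (hc : ∀ P : ι → Prop, CollinearInvariant F h P → ∀ i, ∃ k, P i ↔ P (p k))
    {P : ConeIndex F ι m → Prop} (hP : CollinearInvariant F (coneVec (F := F) h p) P)
    (i : ConeIndex F ι m) : P i ↔ P (.inr (.inl ())) := by
  have hv : ∀ k (a : Fˣ), P (.inr (.inr (k, a))) ↔ P (.inr (.inl ())) := fun k a =>
    hP _ _ ⟨.inl (p k), by simp, by simp, by simp, 1, -(a : F), -1, by simp, by simp, by simp,
      by simp [coneVec]⟩
  have hb : ∀ k, P (.inl (p k)) ↔ P (.inr (.inl ())) := fun k =>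
    hP _ _ ⟨.inr (.inr (k, 1)), by simp, by simp, by simp, 1, 1, -1, by simp, by simp, by simp,
      by simp [coneVec]⟩
  rcases i with i | _ | ⟨k, a⟩
  · obtain ⟨k, hk⟩ := hc _ (hP.comp (LinearMap.inl F U F) Function.Embedding.inl fun _ => rfl) i
    exact hk.trans (hb k)
  · rfl
  · exact hv k a

theorem SpansHyperplanes.cone (hh : SpansHyperplanes F m h)
    (hp : Submodule.span F (Set.range (h ∘ p)) = ⊤) :
    SpansHyperplanes F (m + 1) (coneVec (F := F) h p) := by
  classical
  intro f hf
  have hfu : ∀ u a, f (u, a) = f (u, 0) + a * f (0, 1) := fun u a => by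
    rw [← smul_eq_mul, ← map_smul, ← map_add]; simp
  by_cases h0 : f ∘ₗ LinearMap.inl F U F = 0
  · have h0' : ∀ u, f (u, 0) = 0 := fun u => LinearMap.congr_fun h0 u
    have h1 : f (0, 1) ≠ 0 := fun h1 => hf (by
      ext u <;> simp [h0', h1])
    refine ⟨Finset.univ.image fun k => .inl (p k),
      Nat.succ_le_succ (Finset.card_image_le.trans (by simp)), ?_⟩
    rintro ⟨u, a⟩ hu
    rw [LinearMap.mem_ker, hfu, h0', zero_add, mul_eq_zero, or_iff_left h1] at hu
    subst hu
    have hu : u ∈ Submodule.span F (Set.range (h ∘ p)) := by simp [hp]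
    have h1 := Submodule.mem_map_of_mem (f := LinearMap.inl F U F) hu
    rw [Submodule.map_span] at h1
    refine Submodule.span_mono ?_ h1
    rintro _ ⟨_, ⟨k, rfl⟩, rfl⟩
    exact ⟨.inl (p k), by simp, rfl⟩
  · obtain ⟨J, hJ, hker⟩ := hh _ h0
    obtain ⟨j, hj, hfj⟩ : ∃ j, (coneVec (F := F) h p j).2 ≠ 0 ∧ f (coneVec h p j) = 0 := by
      by_cases h1 : f (0, 1) = 0
      · exact ⟨.inr (.inl ()), by simp [coneVec], h1⟩
      · obtain ⟨k, hk⟩ : ∃ k, f (h (p k), 0) ≠ 0 := by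
          by_contra! hk
          refine h0 (LinearMap.ext_on_range hp fun k => ?_)
          simpa using hk k
        refine ⟨.inr (.inr (k, Units.mk0 (-f (h (p k), 0) / f (0, 1))
          (div_ne_zero (neg_ne_zero.mpr hk) h1))), by simp [coneVec, hk, h1], ?_⟩
        simp only [coneVec, Units.val_mk0]
        rw [hfu]
        field_simp
        ring
    refine ⟨insert j (J.image .inl), ?_, ?_⟩
    · have h1 := Finset.card_insert_le j (J.image Sum.inl)
      have h2 : (J.image (Sum.inl : ι → ConeIndex F ι m)).card ≤ J.card := Finset.card_image_le
      omega
    rintro ⟨u, a⟩ hu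
    obtain ⟨⟨v, b⟩, hv⟩ : ∃ w, coneVec h p j = w := ⟨_, rfl⟩
    rw [hv] at hj hfj
    have hw : u - (a / b) • v ∈ LinearMap.ker (f ∘ₗ LinearMap.inl F U F) := by
      have e : LinearMap.inl F U F (u - (a / b) • v) = (u, a) - (a / b) • (v, b) := by
        ext <;> simp [hj]
      rw [LinearMap.mem_ker, LinearMap.comp_apply, e, map_sub, map_smul, hfj,
        LinearMap.mem_ker.mp hu]
      simp
    have h1 := Submodule.mem_map_of_mem (f := LinearMap.inl F U F) (hker hw)
    rw [Submodule.map_span] at h1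
    have e : ((u, a) : U × F) =
        LinearMap.inl F U F (u - (a / b) • v) + (a / b) • ((v, b) : U × F) := by
      ext <;> simp [show b ≠ 0 from hj]
    rw [e]
    refine Submodule.add_mem _ (Submodule.span_mono ?_ h1) (Submodule.smul_mem _ _
      (Submodule.subset_span ⟨j, by simp, hv⟩))
    rintro _ ⟨_, ⟨k, hk, rfl⟩, rfl⟩
    exact ⟨.inl k, by simpa using Or.inr hk, rfl⟩

end Cone

/-- Vectors representing the points of the projective line over `F`. -/
def lineVec (F : Type*) [Field F] : Option F → F × F
  | none => (1, 0)
  | some x => (x, 1)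

/-- Vectors representing the points of four pairwise skew lines of `PG(3, F)`; when the
polynomial `X ^ 2 - X - c` has no roots, no line meets all four. -/
def skewLinesVec {F : Type*} [Field F] (c : F) : Fin 4 × Option F → (F × F) × (F × F)
  | (0, x) => (lineVec F x, 0)
  | (1, x) => (0, lineVec F x)
  | (2, x) => (lineVec F x, lineVec F x)
  | (3, x) => (lineVec F x, (c * (lineVec F x).2, (lineVec F x).1 + (lineVec F x).2))

/-- One point on each of the four skew lines. -/
def skewLinesPts (F : Type*) [Field F] : Fin 4 → Fin 4 × Option F
  | 0 => (0, none)
  | 1 => (1, none)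
  | 2 => (2, some 0)
  | 3 => (3, none)

section SkewLines

variable {F : Type*} [Field F]

theorem span_skewLinesPts (c : F) :
    Submodule.span F (Set.range (skewLinesVec c ∘ skewLinesPts F)) = ⊤ := by
  rw [eq_top_iff]
  rintro ⟨⟨x, y⟩, ⟨z, w⟩⟩ -
  have hs : ∀ k, skewLinesVec c (skewLinesPts F k) ∈
      Submodule.span F (Set.range (skewLinesVec c ∘ skewLinesPts F)) :=
    fun k => Submodule.subset_span ⟨k, rfl⟩
  have e : (((x, y), (z, w)) : (F × F) × (F × F)) =
      (x - (w - y)) • skewLinesVec c (skewLinesPts F 0) +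
      z • skewLinesVec c (skewLinesPts F 1) +
      y • skewLinesVec c (skewLinesPts F 2) +
      (w - y) • skewLinesVec c (skewLinesPts F 3) := by
    simp [skewLinesVec, skewLinesPts, lineVec]
  rw [e]
  exact Submodule.add_mem _ (Submodule.add_mem _ (Submodule.add_mem _
    (Submodule.smul_mem _ _ (hs 0)) (Submodule.smul_mem _ _ (hs 1)))
    (Submodule.smul_mem _ _ (hs 2))) (Submodule.smul_mem _ _ (hs 3))

theorem collinearInvariant_lineVec {P : Option F → Prop}
    (hP : CollinearInvariant F (lineVec F) P) (i j : Option F) : P i ↔ P j := by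
  have key : ∀ i, P i ↔ P none := by
    rintro (_ | x)
    · rfl
    · exact hP _ _ ⟨some (x + 1), by simp, by simp, by simp, 1, 1, -1, by simp, by simp, by simp,
        by simp [lineVec]⟩
  rw [key i, key j]

theorem collinearInvariant_skewLinesVec (c : F) {P : Fin 4 × Option F → Prop}
    (hP : CollinearInvariant F (skewLinesVec c) P) (i : Fin 4 × Option F) :
    ∃ k, P i ↔ P (skewLinesPts F k) := by
  obtain ⟨k, x⟩ := i
  have main : ∀ φ : (F × F) →ₗ[F] (F × F) × (F × F),
      (∀ x, skewLinesVec c (k, x) = φ (lineVec F x)) → ∀ y, P (k, x) ↔ P (k, y) := fun φ hφ y =>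
    collinearInvariant_lineVec (hP.comp φ ⟨fun x => (k, x), Prod.mk_right_injective k⟩ hφ) x y
  refine ⟨k, ?_⟩
  fin_cases k
  · exact main (LinearMap.inl F _ _) (fun _ => rfl) _
  · exact main (LinearMap.inr F _ _) (fun _ => rfl) _
  · exact main (LinearMap.prod LinearMap.id LinearMap.id) (fun _ => rfl) _
  · exact main (LinearMap.prod LinearMap.id
      (LinearMap.prod (c • LinearMap.snd F F F) (LinearMap.fst F F F + LinearMap.snd F F F)))
      (fun _ => rfl) _

theorem exists_lineVec_mem_ker (f : F × F →ₗ[F] F) : ∃ x, f (lineVec F x) = 0 := by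
  have hf : ∀ x y, f (x, y) = x * f (1, 0) + y * f (0, 1) := fun x y => by
    rw [← smul_eq_mul, ← smul_eq_mul, ← map_smul, ← map_smul, ← map_add]; simp
  by_cases h0 : f (1, 0) = 0
  · exact ⟨none, h0⟩
  · refine ⟨some (-f (0, 1) / f (1, 0)), ?_⟩
    rw [lineVec, hf]
    field_simp
    ring

theorem lineVec_ne_zero (x : Option F) : lineVec F x ≠ 0 := by
  cases x <;> simp [lineVec]

theorem ker_prod_field_le_span {f : F × F →ₗ[F] F} (hf : f ≠ 0) {v : F × F} (hv : v ≠ 0)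
    (hfv : f v = 0) : LinearMap.ker f ≤ Submodule.span F {v} := by
  have h1 : Submodule.span F {v} ≤ LinearMap.ker f := by simpa using hfv
  have h2 := LinearMap.finrank_range_add_finrank_ker f
  have h3 : Module.finrank F (LinearMap.range f) = 1 := by
    rw [LinearMap.range_eq_top.mpr (LinearMap.surjective hf)]; simp
  refine (Submodule.eq_of_le_of_finrank_eq h1 ?_).ge
  rw [finrank_span_singleton hv]
  simp at h2
  omega

theorem spansHyperplanes_skewLinesVec {c : F} (hc : ∀ x : F, x * x - x ≠ c) :
    SpansHyperplanes F 4 (skewLinesVec c) := by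
  classical
  intro f hf
  set α := f ∘ₗ LinearMap.inl F (F × F) (F × F) with hα
  set β := f ∘ₗ LinearMap.inr F (F × F) (F × F) with hβ
  set T : F × F →ₗ[F] F × F :=
    LinearMap.prod (c • LinearMap.snd F F F) (LinearMap.fst F F F + LinearMap.snd F F F) with hT
  have hfab : ∀ x y, f (x, y) = α x + β y := fun x y => by
    simp [hα, hβ, ← map_add]
  obtain ⟨a, ha⟩ := exists_lineVec_mem_ker α
  obtain ⟨b, hb⟩ := exists_lineVec_mem_ker β
  have hker : ∀ {g : F × F →ₗ[F] F} {x y : F × F}, g ≠ 0 → x ≠ 0 → g x = 0 → g y = 0 →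
      ∃ t : F, t • x = y := fun hg hx hgx hgy =>
    Submodule.mem_span_singleton.mp (ker_prod_field_le_span hg hx hgx hgy)
  by_cases hα0 : α = 0
  · have hβ0 : β ≠ 0 := fun hβ0 => hf (by
      ext <;> simp [hfab, hα0, hβ0])
    refine ⟨{(0, none), (0, some 0), (1, b)}, Nat.succ_le_succ Finset.card_le_three, ?_⟩
    rintro ⟨x, y⟩ hxy
    rw [LinearMap.mem_ker, hfab, hα0, LinearMap.zero_apply, zero_add] at hxy
    obtain ⟨t, rfl⟩ := hker hβ0 (lineVec_ne_zero b) hb hxy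
    simp only [Finset.coe_insert, Finset.coe_singleton, Set.image_insert_eq, Set.image_singleton,
      Submodule.mem_span_insert, Submodule.mem_span_singleton]
    exact ⟨x.1, _, ⟨x.2, _, ⟨t, rfl⟩, rfl⟩, by ext <;> simp [skewLinesVec, lineVec]⟩
  by_cases hβ0 : β = 0
  · refine ⟨{(1, none), (1, some 0), (0, a)}, Nat.succ_le_succ Finset.card_le_three, ?_⟩
    rintro ⟨x, y⟩ hxy
    rw [LinearMap.mem_ker, hfab, hβ0, LinearMap.zero_apply, add_zero] at hxy
    obtain ⟨t, rfl⟩ := hker hα0 (lineVec_ne_zero a) ha hxy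
    simp only [Finset.coe_insert, Finset.coe_singleton, Set.image_insert_eq, Set.image_singleton,
      Submodule.mem_span_insert, Submodule.mem_span_singleton]
    exact ⟨y.1, _, ⟨y.2, _, ⟨t, rfl⟩, rfl⟩, by ext <;> simp [skewLinesVec, lineVec]⟩
  obtain ⟨j, u, w, hj, hfj, hu⟩ : ∃ j u w, skewLinesVec c j = (u, w) ∧ f (u, w) = 0 ∧ α u ≠ 0 := by
    obtain ⟨d, hd⟩ := exists_lineVec_mem_ker (α + β)
    obtain ⟨e, he⟩ := exists_lineVec_mem_ker (α + β ∘ₗ T)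
    by_cases h1 : α (lineVec F d) = 0
    · refine ⟨(3, e), lineVec F e, T (lineVec F e), rfl, by rw [hfab]; exact he, fun h2 => ?_⟩
      rw [LinearMap.add_apply, h1, zero_add] at hd
      rw [LinearMap.add_apply, h2, zero_add, LinearMap.comp_apply] at he
      obtain ⟨s, hs⟩ := hker hα0 (lineVec_ne_zero d) h1 h2
      obtain ⟨r, hr⟩ := hker hβ0 (lineVec_ne_zero e) (by rw [← hs, map_smul, hd, smul_zero]) he
      obtain _ | x := e
      · have h3 := congrArg Prod.fst hr
        have h4 := congrArg Prod.snd hr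
        simp [lineVec, hT] at h3 h4
      · have h3 := congrArg Prod.fst hr
        have h4 := congrArg Prod.snd hr
        simp [lineVec, hT] at h3 h4
        subst h4
        exact hc (x + 1) (by rw [← h3]; ring)
    · exact ⟨(2, d), _, _, rfl, by rw [hfab]; exact hd, h1⟩
  refine ⟨{(0, a), (1, b), j}, Nat.succ_le_succ Finset.card_le_three, ?_⟩
  rintro ⟨x, y⟩ hxy
  rw [LinearMap.mem_ker, hfab] at hxy
  rw [hfab] at hfj
  obtain ⟨t, ht⟩ := hker (y := x - (α x / α u) • u) hα0 (lineVec_ne_zero a) ha (by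
    simp only [map_sub, map_smul, smul_eq_mul]; field_simp; ring)
  obtain ⟨s, hs⟩ := hker (y := y - (α x / α u) • w) hβ0 (lineVec_ne_zero b) hb (by
    simp only [map_sub, map_smul, smul_eq_mul]
    rw [eq_neg_of_add_eq_zero_right hfj, eq_neg_of_add_eq_zero_right hxy]
    field_simp
    ring)
  simp only [Finset.coe_insert, Finset.coe_singleton, Set.image_insert_eq, Set.image_singleton,
    Submodule.mem_span_insert, Submodule.mem_span_singleton]
  refine ⟨t, _, ⟨s, _, ⟨α x / α u, rfl⟩, rfl⟩, ?_⟩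
  rw [hj]
  simp [skewLinesVec, ht, hs]

end SkewLines

theorem exists_quadratic_nonvalue (F : Type*) [Field F] [Finite F] :
    ∃ c : F, ∀ x : F, x * x - x ≠ c := by
  by_contra! hc
  have hinj : Function.Injective fun x : F => x * x - x := Finite.injective_iff_surjective.mpr hc
  exact zero_ne_one (hinj (by simp : (fun x : F => x * x - x) 0 = (fun x : F => x * x - x) 1))

/-- A configuration of `n` vectors spanning all hyperplanes of `F ^ m`, in which collinear
adjacency connects every index to one of a spanning set of base points. -/
def ExistsConfiguration (F : Type) [Field F] (m n : ℕ) : Prop :=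
  ∃ (ι : Type) (_ : Fintype ι) (h : ι → Fin m → F) (p : Fin m → ι),
    Fintype.card ι = n ∧ SpansHyperplanes F m h ∧
    Submodule.span F (Set.range (h ∘ p)) = ⊤ ∧
    ∀ P, CollinearInvariant F h P → ∀ i, ∃ k, P i ↔ P (p k)

/-- A configuration of `n` vectors spanning all hyperplanes of `F ^ m`, connected by collinear
adjacency. -/
def ExistsConnectedConfiguration (F : Type) [Field F] (m n : ℕ) : Prop :=
  ∃ (ι : Type) (_ : Fintype ι) (h : ι → Fin m → F),
    Fintype.card ι = n ∧ SpansHyperplanes F m h ∧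
    ∀ P, CollinearInvariant F h P → ∀ i j, P i ↔ P j

section Configuration

variable (F : Type) [Field F] [Fintype F]

theorem existsConfiguration_four : ExistsConfiguration F 4 (4 * (Fintype.card F + 1)) := by
  obtain ⟨c, hc⟩ := exists_quadratic_nonvalue F
  let φ : ((F × F) × (F × F)) ≃ₗ[F] (Fin 4 → F) := LinearEquiv.ofFinrankEq _ _ (by simp)
  exact ⟨Fin 4 × Option F, inferInstance, φ ∘ skewLinesVec c, skewLinesPts F, by simp,
    (spansHyperplanes_skewLinesVec hc).map_equiv φ,
    span_range_linearEquiv φ (span_skewLinesPts c), fun P hP i =>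
      collinearInvariant_skewLinesVec c
        (hP.comp (h := skewLinesVec c) φ.toLinearMap (Function.Embedding.refl _) fun _ => rfl) i⟩

variable {F}

theorem ExistsConfiguration.cone {m n : ℕ} (H : ExistsConfiguration F m n) :
    ExistsConfiguration F (m + 1) (n + 1 + m * (Fintype.card F - 1)) ∧
    ExistsConnectedConfiguration F (m + 1) (n + 1 + m * (Fintype.card F - 1)) := by
  classical
  obtain ⟨ι, _, h, p, hn, hh, hp, hc⟩ := H
  let φ : ((Fin m → F) × F) ≃ₗ[F] (Fin (m + 1) → F) := LinearEquiv.ofFinrankEq _ _ (by simp)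
  have hcard : Fintype.card (ConeIndex F ι m) = n + 1 + m * (Fintype.card F - 1) := by
    simp [hn, Fintype.card_units, add_assoc]
  have key : ∀ P, CollinearInvariant F (φ ∘ coneVec h p) P → ∀ i : ConeIndex F ι m,
      P i ↔ P (.inr (.inl ())) := fun P hP i =>
    collinearInvariant_coneVec hc
      (hP.comp (h := coneVec h p) φ.toLinearMap (Function.Embedding.refl _) fun _ => rfl) i
  exact ⟨⟨_, inferInstance, φ ∘ coneVec h p, conePts p, hcard, (hh.cone hp).map_equiv φ,
      span_range_linearEquiv φ (span_conePts hp), fun P hP i => ⟨0, key P hP i⟩⟩,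
    ⟨_, inferInstance, φ ∘ coneVec h p, hcard, (hh.cone hp).map_equiv φ,
      fun P hP i j => (key P hP i).trans (key P hP j).symm⟩⟩

theorem exists_connectedConfiguration {R : ℕ} (hR : 4 ≤ R) :
    ExistsConnectedConfiguration F (R + 1)
      ((Fintype.card F - 1) * (R * (R + 1) / 2 - 2) + R + 5) := by
  have hF : 1 < Fintype.card F := Fintype.one_lt_card
  have hstep : ∀ r : ℕ, 3 ≤ r → (Fintype.card F - 1) * (r * (r + 1) / 2 - 2) + r + 5 + 1 +
      (r + 1) * (Fintype.card F - 1) =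
      (Fintype.card F - 1) * ((r + 1) * (r + 1 + 1) / 2 - 2) + (r + 1) + 5 := fun r hr => by
    have e1 : (r + 1) * (r + 1 + 1) / 2 = r * (r + 1) / 2 + (r + 1) := by
      rw [show (r + 1) * (r + 1 + 1) = r * (r + 1) + (r + 1) * 2 by ring,
        Nat.add_mul_div_right _ _ two_pos]
    have e2 : 2 ≤ r * (r + 1) / 2 := by
      rw [Nat.le_div_iff_mul_le two_pos]; nlinarith
    rw [e1, show r * (r + 1) / 2 + (r + 1) - 2 = r * (r + 1) / 2 - 2 + (r + 1) by omega]
    ring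
  have main : ∀ r : ℕ, 3 ≤ r → ExistsConfiguration F (r + 1)
      ((Fintype.card F - 1) * (r * (r + 1) / 2 - 2) + r + 5) := fun r hr => by
    induction r, hr using Nat.le_induction with
    | base =>
      convert existsConfiguration_four F using 1
      norm_num
      omega
    | succ r hr ih => exact hstep r hr ▸ ih.cone.1
  obtain ⟨r, rfl⟩ : ∃ r, R = r + 1 := ⟨R - 1, by omega⟩
  exact hstep r (by omega) ▸ (main r (by omega)).cone.2

end Configuration

open scoped Classical in
/-- Every vector of `W` is a combination of at most `R` of the vectors `H j`, and some vector is
not a combination of fewer than `R` of them. -/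
def IsCoveringFamily (L : Type*) {W κ : Type*} [Field L] [AddCommGroup W] [Module L W]
    [Fintype κ] (H : κ → W) (R : ℕ) : Prop :=
  (∀ w, ∃ c : κ → L, ∑ j, c j • H j = w ∧ (Finset.univ.filter fun j => c j ≠ 0).card ≤ R) ∧
  ∃ w, ∀ c : κ → L, ∑ j, c j • H j = w → R ≤ (Finset.univ.filter fun j => c j ≠ 0).card

section Codes

variable {L W κ : Type*} [Field L] [AddCommGroup W] [Module L W] [Fintype κ]

theorem IsCoveringFamily.existsCovCode [DecidableEq L] [FiniteDimensional L W] {H : κ → W} {R : ℕ}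
    (hH : IsCoveringFamily L H R) :
    ExistsCovCode L (Fintype.card κ) (Module.finrank L W) R := by
  classical
  let e := (Fintype.equivFin κ).symm
  let φ : (Fin (Fintype.card κ) → L) →ₗ[L] W := Fintype.linearCombination L (H ∘ e)
  have hφ : ∀ x, φ x = ∑ j, x (e.symm j) • H j := fun x => by
    rw [Fintype.linearCombination_apply, ← e.sum_comp]
    simp
  have hnorm : ∀ x : Fin (Fintype.card κ) → L,
      hammingNorm x = (Finset.univ.filter fun j => x (e.symm j) ≠ 0).card := fun x =>
    Finset.card_equiv e (by simp)
  have hsurj : Function.Surjective φ := fun w => by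
    obtain ⟨c, hc, -⟩ := hH.1 w
    exact ⟨c ∘ e, by simpa [hφ] using hc⟩
  have hrank := LinearMap.finrank_range_add_finrank_ker φ
  rw [LinearMap.range_eq_top.mpr hsurj, finrank_top, Module.finrank_fin_fun] at hrank
  refine ⟨by omega, LinearMap.ker φ, by omega, fun x => ?_, ?_⟩
  · obtain ⟨c, hc, hcR⟩ := hH.1 (φ x)
    have hce : φ (c ∘ e) = φ x := by simpa [hφ] using hc
    refine ⟨x - c ∘ e, by simp [hce], ?_⟩
    rw [hammingDist_comm, hammingDist_eq_hammingNorm, neg_sub, sub_add_cancel, hnorm]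
    simpa using hcR
  · obtain ⟨w, hw⟩ := hH.2
    obtain ⟨x, rfl⟩ := hsurj w
    refine ⟨x, fun c hc => ?_⟩
    rw [hammingDist_comm, hammingDist_eq_hammingNorm, hnorm]
    convert hw (fun j => (-c + x) (e.symm j)) ?_
    rw [← hφ, map_add, map_neg, LinearMap.mem_ker.mp hc, neg_zero, zero_add]

end Codes

section Extension

variable {K L : Type*} [Field K] [Field L] [Algebra K L] {ι : Type*} {m R : ℕ}

/-- The vectors of a family over a subfield, seen over the extension field. -/
def extendVec (L : Type*) [Field L] [Algebra K L] (h : ι → Fin m → K) (i : ι) : Fin m → L :=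
  fun k => algebraMap K L (h i k)

theorem CollinearAdj.extend {h : ι → Fin m → K} {i j : ι} (hij : CollinearAdj K h i j) :
    CollinearAdj L (extendVec L h) i j := by
  obtain ⟨k, h1, h2, h3, a, b, c, ha, hb, hc, habc⟩ := hij
  refine ⟨k, h1, h2, h3, algebraMap K L a, algebraMap K L b, algebraMap K L c, by simpa, by simpa,
    by simpa, ?_⟩
  ext l
  have := congrArg (algebraMap K L) (congrFun habc l)
  simpa [extendVec, Algebra.smul_def] using this

open scoped Classical in
theorem SpansHyperplanes.exists_combination [FiniteDimensional K L] [Fintype ι]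
    (hL : Module.finrank K L = R) {h : ι → Fin (R + 1) → K} (hh : SpansHyperplanes K (R + 1) h)
    (s : Fin (R + 1) → L) :
    ∃ c : ι → L, ∑ i, c i • extendVec L h i = s ∧
      (Finset.univ.filter fun i => c i ≠ 0).card ≤ R := by
  let b := Module.finBasisOfFinrankEq K L hL
  obtain ⟨g, hg, k₀, hk₀⟩ : ∃ g : Fin (R + 1) → K, ∑ k, g k • s k = 0 ∧ ∃ k, g k ≠ 0 := by
    refine Fintype.not_linearIndependent_iff.mp fun hli => ?_
    have := hli.fintype_card_le_finrank
    simp [hL] at this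
  let f : (Fin (R + 1) → K) →ₗ[K] K := Fintype.linearCombination K g
  obtain ⟨J, hJ, hker⟩ := hh f (fun hf => hk₀ (by
    have := LinearMap.congr_fun hf (Pi.single k₀ 1)
    simpa [f, Fintype.linearCombination_apply_single] using this))
  have hmem : ∀ r : Fin R, (fun k => b.repr (s k) r) ∈ Submodule.span K (h '' J) := fun r => by
    apply hker
    have := congrArg (fun x => b.repr x r) hg
    simpa [f, Fintype.linearCombination_apply, mul_comm, Finsupp.finsetSum_apply] using this
  have hcoef : ∀ r : Fin R, ∃ a : ι → K, (∀ i ∉ J, a i = 0) ∧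
      ∑ i, a i • h i = fun k => b.repr (s k) r := fun r => by
    obtain ⟨a, ha⟩ := Submodule.mem_span_image_finset_iff_exists_fun' K |>.mp (hmem r)
    refine ⟨fun i => if i ∈ J then a i else 0, fun i hi => if_neg hi, ?_⟩
    simpa [ite_smul, Finset.sum_ite_mem] using ha
  choose a ha hs using hcoef
  refine ⟨fun i => ∑ r, a r i • b r, ?_, ?_⟩
  · ext k
    rw [← b.sum_repr (s k)]
    have : ∀ r, b.repr (s k) r = ∑ i, a r i * h i k := fun r => by
      rw [← congrFun (hs r) k]; simp
    simp only [this, Finset.sum_apply, Pi.smul_apply, extendVec, smul_eq_mul,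
      Finset.sum_smul]
    rw [Finset.sum_comm]
    refine Finset.sum_congr rfl fun r _ => Finset.sum_congr rfl fun i _ => ?_
    simp only [Algebra.smul_def, map_mul]
    ring
  · refine (Finset.card_le_card fun i hi => ?_).trans (Nat.succ_le_succ_iff.mp hJ)
    by_contra hiJ
    exact (Finset.mem_filter.mp hi).2 (Finset.sum_eq_zero fun r _ => by simp [ha r i hiJ])

open scoped Classical in
theorem exists_le_card_support_combination [FiniteDimensional K L]
    (hL : Module.finrank K L = R) [Fintype ι] (h : ι → Fin (R + 1) → K) :
    ∃ s : Fin (R + 1) → L, ∀ c : ι → L, ∑ i, c i • extendVec L h i = s →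
      R ≤ (Finset.univ.filter fun i => c i ≠ 0).card := by
  let b := Module.finBasisOfFinrankEq K L hL
  refine ⟨Fin.cons 0 b, fun c hc => ?_⟩
  set S := Finset.univ.filter fun i => c i ≠ 0 with hS
  have hspan : (⊤ : Submodule K L) ≤ Submodule.span K (S.image c : Set L) := by
    rw [← b.span_eq, Submodule.span_le]
    rintro _ ⟨r, rfl⟩
    have h1 := congrFun hc r.succ
    rw [Fin.cons_succ] at h1
    rw [← h1, Finset.sum_apply]
    refine Submodule.sum_mem _ fun i _ => ?_
    by_cases hi : c i = 0
    · simp [hi]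
    · have : (c i • extendVec L h i) r.succ = h i r.succ • c i := by
        simp [extendVec, Algebra.smul_def, mul_comm]
      rw [this]
      exact Submodule.smul_mem _ _ (Submodule.subset_span (by
        rw [Finset.mem_coe]; exact Finset.mem_image_of_mem c (by simp [hS, hi])))
  have h1 := finrank_span_finset_le_card (R := K) (S.image c)
  rw [Set.finrank, top_le_iff.mp hspan, finrank_top, hL] at h1
  exact h1.trans Finset.card_image_le

end Extension

section Enlarge

variable {L W ι : Type*} [Field L] [AddCommGroup W] [Module L W] [Fintype ι]
  {h : ι → W}

open scoped Classical in
theorem exists_nonzero_combination_eq_zero [Nontrivial ι]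
    (hconn : ∀ P, CollinearInvariant L h P → ∀ i j, P i ↔ P j) :
    ∃ c : ι → L, c ≠ 0 ∧ ∑ i, c i • h i = 0 ∧
      (Finset.univ.filter fun i => c i ≠ 0).card ≤ 3 := by
  obtain ⟨i, j, k, hij, hik, hjk, x, y, z, hx, hy, hz, hrel⟩ : ∃ i j, CollinearAdj L h i j := by
    by_contra! H
    obtain ⟨i, j, hij⟩ := exists_pair_ne ι
    exact hij ((hconn (· = j) (fun a b hab => (H a b hab).elim) i j).mpr rfl)
  refine ⟨Pi.single i x + Pi.single j y + Pi.single k z, fun h0 => hx ?_, ?_, ?_⟩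
  · simpa [hij, hik] using congrFun h0 i
  · simpa [Pi.single_apply, add_smul, Finset.sum_add_distrib] using hrel
  · refine (Finset.card_le_card (t := {i, j, k}) fun l hl => ?_).trans Finset.card_le_three
    by_contra hl'
    simp only [Finset.mem_insert, Finset.mem_singleton, not_or] at hl'
    simp [hl'] at hl

variable [Fintype L]

open scoped Classical in
theorem exists_combination_card_succ (h4 : 4 ≤ Fintype.card L)
    (hconn : ∀ P, CollinearInvariant L h P → ∀ i j, P i ↔ P j) {c : ι → L} (hc : c ≠ 0)
    (hlt : (Finset.univ.filter fun i => c i ≠ 0).card < Fintype.card ι) :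
    ∃ c' : ι → L, ∑ i, c' i • h i = ∑ i, c i • h i ∧
      (Finset.univ.filter fun i => c' i ≠ 0).card =
        (Finset.univ.filter fun i => c i ≠ 0).card + 1 := by
  obtain ⟨i₀, hi₀⟩ := Function.ne_iff.mp hc
  obtain ⟨j₀, hj₀⟩ : ∃ j, c j = 0 := by
    by_contra! H
    simp [H] at hlt
  obtain ⟨i, j, ⟨k, hij, hik, hjk, x, y, z, hx, hy, hz, hrel⟩, hi, hj⟩ :
      ∃ i j, CollinearAdj L h i j ∧ c i ≠ 0 ∧ c j = 0 := by
    by_contra! H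
    have hsymm : ∀ i j, CollinearAdj L h i j → CollinearAdj L h j i := by
      rintro i j ⟨k, h1, h2, h3, a, b, c, ha, hb, hc, habc⟩
      exact ⟨k, h1.symm, h3, h2, b, a, c, hb, ha, hc, by rw [← habc]; abel⟩
    exact (hconn (fun i => c i ≠ 0)
      (fun i j hij => ⟨H i j hij, H j i (hsymm i j hij)⟩) i₀ j₀).mp hi₀ hj₀
  have hsum : ∀ d : L, ∑ l, (c + d • (Pi.single i x + Pi.single j y + Pi.single k z) : ι → L) l • h l =
      ∑ l, c l • h l := fun d => by
    simp only [Pi.add_apply, Pi.smul_apply, add_smul, Finset.sum_add_distrib, smul_assoc,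
      ← Finset.smul_sum, smul_add]
    simp only [Pi.single_apply, ite_smul, zero_smul, Finset.sum_ite_eq', Finset.mem_univ, if_true]
    rw [← smul_add, ← smul_add, hrel, smul_zero, add_zero]
  by_cases hk : c k = 0
  · refine ⟨_, hsum (-c i / x), ?_⟩
    have : (Finset.univ.filter fun l => (c + (-c i / x) •
        (Pi.single i x + Pi.single j y + Pi.single k z) : ι → L) l ≠ 0) =
        insert j (insert k ((Finset.univ.filter fun l => c l ≠ 0).erase i)) := by
      ext l
      rcases eq_or_ne l i with rfl | h1
      · simp [hij, hik, hx]
      rcases eq_or_ne l j with rfl | h2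
      · simp [hij.symm, hjk, hj, hi, hx, hy]
      rcases eq_or_ne l k with rfl | h3
      · simp [hik.symm, hjk.symm, hk, hi, hx, hz]
      simp [h1, h2, h3]
    rw [this, Finset.card_insert_of_notMem, Finset.card_insert_of_notMem, Finset.card_erase_of_mem]
    · have : 0 < (Finset.univ.filter fun l => c l ≠ 0).card :=
        Finset.card_pos.mpr ⟨i, by simp [hi]⟩
      omega
    · simp [hi]
    · simp [hk]
    · simp [hj, hjk]
  · obtain ⟨d, hd⟩ : ∃ d, d ∉ ({0, -c i / x, -c k / z} : Finset L) := by
      by_contra! H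
      have h1 : Fintype.card L ≤ 3 := by
        rw [← Finset.card_univ, ← Finset.eq_univ_of_forall H]
        exact Finset.card_le_three
      omega
    simp only [Finset.mem_insert, Finset.mem_singleton, not_or] at hd
    obtain ⟨hd0, hdi, hdk⟩ := hd
    refine ⟨_, hsum d, ?_⟩
    have : (Finset.univ.filter fun l => (c + d •
        (Pi.single i x + Pi.single j y + Pi.single k z) : ι → L) l ≠ 0) =
        insert j (Finset.univ.filter fun l => c l ≠ 0) := by
      ext l
      rcases eq_or_ne l i with rfl | h1
      · have : c l + d * x ≠ 0 := fun h0 => hdi (by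
          rw [eq_div_iff hx]; exact eq_neg_of_add_eq_zero_right h0)
        simp [hij, hik, hi, this]
      rcases eq_or_ne l j with rfl | h2
      · simp [hij.symm, hjk, hj, hd0, hy]
      rcases eq_or_ne l k with rfl | h3
      · have : c l + d * z ≠ 0 := fun h0 => hdk (by
          rw [eq_div_iff hz]; exact eq_neg_of_add_eq_zero_right h0)
        simp [hik.symm, hjk.symm, hk, this]
      simp [h1, h2, h3]
    rw [this, Finset.card_insert_of_notMem (by simp [hj])]

open scoped Classical in
theorem exists_combination_card_eq (h4 : 4 ≤ Fintype.card L)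
    (hconn : ∀ P, CollinearInvariant L h P → ∀ i j, P i ↔ P j) {R : ℕ} (hR : 3 ≤ R)
    (hι : R ≤ Fintype.card ι) (c : ι → L)
    (hc : (Finset.univ.filter fun i => c i ≠ 0).card ≤ R) :
    ∃ c' : ι → L, ∑ i, c' i • h i = ∑ i, c i • h i ∧
      (Finset.univ.filter fun i => c' i ≠ 0).card = R := by
  wlog hc0 : c ≠ 0 generalizing c with H
  · have : Nontrivial ι := Fintype.one_lt_card_iff_nontrivial.mp (by omega)
    obtain ⟨c₁, h1, h2, h3⟩ := exists_nonzero_combination_eq_zero hconn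
    obtain ⟨c', h5, h6⟩ := H c₁ (h3.trans hR) h1
    exact ⟨c', by rw [h5, h2, not_not.mp hc0]; simp, h6⟩
  induction hn : R - (Finset.univ.filter fun i => c i ≠ 0).card generalizing c with
  | zero => exact ⟨c, rfl, by omega⟩
  | succ n ih =>
    obtain ⟨c₁, h1, h2⟩ := exists_combination_card_succ h4 hconn hc0 (by omega)
    obtain ⟨c', h3, h5⟩ := ih c₁ (by omega) (fun h0 => by subst h0; simp at h2) (by omega)
    exact ⟨c', h3.trans h1, h5⟩

end Enlarge

section Concatenation

variable {L W M ι : Type*} [Field L] [AddCommGroup W] [Module L W] [Field M] [Algebra L M]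
  {R : ℕ}

/-- The columns of the concatenated parity check matrix built from the columns `h` and the
pairwise distinct indicators `β`. -/
def concatVec (R : ℕ) (h : ι → W) (β : ι → M) (x : ι × M) : W × (Fin R → M) :=
  (h x.1, fun k => β x.1 ^ (k : ℕ) * x.2)

theorem exists_sum_pow_mul_eq {n : ℕ} {b : Fin n → M} (hb : Function.Injective b)
    (u : Fin n → M) : ∃ η : Fin n → M, ∀ k : Fin n, ∑ a, b a ^ (k : ℕ) * η a = u k := by
  have hdet : IsUnit (Matrix.vandermonde b).transpose.det := by
    rw [Matrix.det_transpose]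
    exact (Matrix.det_vandermonde_ne_zero_iff.mpr hb).isUnit
  obtain ⟨η, hη⟩ := Matrix.mulVec_surjective_iff_isUnit.mpr
    ((Matrix.isUnit_iff_isUnit_det _).mpr hdet) u
  refine ⟨η, fun k => ?_⟩
  rw [← hη]
  rfl

open scoped Classical in
theorem isCoveringFamily_concatVec [Fintype ι] [Fintype M] {h : ι → W} {β : ι → M}
    (hβ : Function.Injective β)
    (hcover : ∀ s, ∃ c : ι → L, ∑ i, c i • h i = s ∧
      (Finset.univ.filter fun i => c i ≠ 0).card = R)
    (hlower : ∃ s, ∀ c : ι → L, ∑ i, c i • h i = s →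
      R ≤ (Finset.univ.filter fun i => c i ≠ 0).card) :
    IsCoveringFamily L (concatVec R h β) R := by
  constructor
  · rintro ⟨s, u⟩
    obtain ⟨c, hc, hcR⟩ := hcover s
    let e := (Finset.equivFinOfCardEq hcR).symm
    obtain ⟨η, hη⟩ := exists_sum_pow_mul_eq
      (b := fun a => β (e a)) (fun a b hab => e.injective (Subtype.ext (hβ hab))) u
    let ξ : ι → M := fun i =>
      if hi : i ∈ Finset.univ.filter fun i => c i ≠ 0 then
        (algebraMap L M (c i))⁻¹ * η (e.symm ⟨i, hi⟩) else 0
    refine ⟨fun x => if x.2 = ξ x.1 then c x.1 else 0, ?_, ?_⟩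
    · have hsum : ∑ x : ι × M, (if x.2 = ξ x.1 then c x.1 else 0) • concatVec R h β x =
          ∑ i, c i • concatVec R h β (i, ξ i) := by
        rw [Fintype.sum_prod_type]
        simp [ite_smul]
      rw [hsum]
      refine Prod.ext ?_ (funext fun k => ?_)
      · rw [Prod.fst_sum]
        exact hc
      · rw [Prod.snd_sum, Finset.sum_apply]
        refine Eq.trans ?_ (hη k)
        have h1 : ∑ i, (c i • concatVec R h β (i, ξ i)).2 k =
            ∑ i ∈ Finset.univ.filter fun i => c i ≠ 0, c i • (β i ^ (k : ℕ) * ξ i) := by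
          rw [Finset.sum_filter]
          refine Finset.sum_congr rfl fun i _ => ?_
          by_cases hi : c i = 0 <;> simp [hi, concatVec]
        rw [h1, ← Finset.sum_coe_sort, ← e.sum_comp]
        refine Finset.sum_congr rfl fun a _ => ?_
        have h2 : algebraMap L M (c (e a)) ≠ 0 := by
          simpa using (Finset.mem_filter.mp (e a).2).2
        have h3 : ξ (e a) = (algebraMap L M (c (e a)))⁻¹ * η a := by
          simp only [ξ]
          rw [dif_pos (e a).2]
          simp
        rw [h3, Algebra.smul_def]
        field_simp
    · rw [← hcR]
      refine Finset.card_le_card_of_injOn Prod.fst (fun x hx => ?_) (fun x hx y hy hxy => ?_)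
      · simp_all
      · simp only [Finset.coe_filter, Finset.mem_univ, true_and, Set.mem_ofPred_eq, ne_eq,
          ite_eq_right_iff, Classical.not_imp] at hx hy
        exact Prod.ext hxy (by rw [hx.1, hy.1, hxy])
  · obtain ⟨s, hs⟩ := hlower
    refine ⟨(s, 0), fun c hc => ?_⟩
    have h1 : ∑ i, (∑ y, c (i, y)) • h i = s := by
      have := congrArg Prod.fst hc
      rw [Prod.fst_sum, Fintype.sum_prod_type] at this
      simpa [concatVec, Finset.sum_smul] using this
    refine (hs _ h1).trans ((Finset.card_le_card fun i hi => ?_).trans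
      (Finset.card_image_le (f := Prod.fst)))
    obtain ⟨y, -, hy⟩ := Finset.exists_ne_zero_of_sum_ne_zero (Finset.mem_filter.mp hi).2
    exact Finset.mem_image.mpr ⟨(i, y), by simpa using hy, rfl⟩

end Concatenation

theorem exists_subfield_algebra {L : Type*} [Field L] [Fintype L] {q R : ℕ} (hq : IsPrimePow q)
    (hR : R ≠ 0) (hL : Fintype.card L = q ^ R) :
    ∃ (K : Type) (_ : Field K) (_ : Fintype K) (_ : Algebra K L),
      Fintype.card K = q ∧ Module.finrank K L = R := by
  obtain ⟨p, k, hp, hk, rfl⟩ := (isPrimePow_nat_iff _).mp hq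
  have : Fact p.Prime := ⟨hp⟩
  have : NeZero R := ⟨hR⟩
  let K := GaloisField p k
  have hK : Nat.card K = p ^ k := GaloisField.card p k hk.ne'
  let : Fintype K := Fintype.ofFinite K
  let : Fintype (FiniteField.Extension K p R) := Fintype.ofFinite _
  let e : FiniteField.Extension K p R ≃+* L := FiniteField.ringEquivOfCardEq (by
    rw [Fintype.card_eq_nat_card, FiniteField.natCard_extension, hK, hL])
  let : Algebra K L := (e.toRingHom.comp (algebraMap K (FiniteField.Extension K p R))).toAlgebra
  have hcard : Fintype.card K = p ^ k := by rw [Fintype.card_eq_nat_card, hK]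
  refine ⟨K, inferInstance, inferInstance, inferInstance, hcard, ?_⟩
  have h1 := Module.card_eq_pow_finrank (K := K) (V := L)
  rw [hL, hcard] at h1
  exact (Nat.pow_right_injective hq.one_lt h1).symm

theorem exists_field_extension (L : Type*) [Field L] [Fintype L] {n : ℕ} (hn : n ≠ 0) :
    ∃ (M : Type) (_ : Field M) (_ : Fintype M) (_ : Algebra L M),
      Fintype.card M = Fintype.card L ^ n ∧ Module.finrank L M = n := by
  obtain ⟨p, _⟩ := CharP.exists L
  have : Fact p.Prime := ⟨CharP.char_is_prime L p⟩
  have : NeZero n := ⟨hn⟩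
  let : Fintype (FiniteField.Extension L p n) := Fintype.ofFinite _
  exact ⟨FiniteField.Extension L p n, inferInstance, inferInstance, inferInstance, by
    rw [Fintype.card_eq_nat_card, FiniteField.natCard_extension, Nat.card_eq_fintype_card],
    FiniteField.finrank_extension L p n⟩

/-- Theorem 26. Let `R ≥ 4`, `q = q'^R`, and
`n₁ = (q'-1)(R(R+1)/2 - 2) + R + 5`. For every `t ≥ 1` with `t = 1` or `q^{t-1} ≥ n₁`
there is a `[n, n-(Rt+1)]_q` code of covering radius `R` with
`n = n₁ q^{t-1} + w (q^{t-1}-1)/(q-1)`, `w ∈ {0,1}`, `w = 0` whenever `q' ≥ 4`. -/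
theorem statement18 (R : ℕ) (hR : 4 ≤ R) (q' : ℕ) (hq' : IsPrimePow q') (h3 : 3 ≤ q')
    (L : Type*) [Field L] [Fintype L] [DecidableEq L]
    (hL : Fintype.card L = q' ^ R)
    (t : ℕ) (ht : 1 ≤ t)
    (hcond : t = 1 ∨
      (q' - 1) * (R * (R + 1) / 2 - 2) + R + 5 ≤ (q' ^ R) ^ (t - 1)) :
    ∃ w : ℕ, w ≤ 1 ∧ (4 ≤ q' → w = 0) ∧
      ExistsCovCode L
        (((q' - 1) * (R * (R + 1) / 2 - 2) + R + 5) * (q' ^ R) ^ (t - 1) +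
          w * (((q' ^ R) ^ (t - 1) - 1) / (q' ^ R - 1)))
        (R * t + 1) R := by
  classical
  obtain ⟨K, _, _, _, rfl, hKL⟩ := exists_subfield_algebra hq' (by omega) hL
  obtain ⟨ι, _, h, hn, hh, hconn⟩ := exists_connectedConfiguration (F := K) hR
  refine ⟨0, zero_le_one, fun _ => rfl, ?_⟩
  rw [zero_mul, add_zero, ← hn]
  rw [← hn] at hcond
  have hι : R ≤ Fintype.card ι := by omega
  have h4 : 4 ≤ Fintype.card L := by
    rw [hL]
    calc 4 ≤ 3 ^ 2 := by norm_num
      _ ≤ Fintype.card K ^ 2 := Nat.pow_le_pow_left h3 2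
      _ ≤ Fintype.card K ^ R := Nat.pow_le_pow_right (by omega) (by omega)
  have hconn' : ∀ P, CollinearInvariant L (extendVec L h) P → ∀ i j, P i ↔ P j :=
    fun P hP => hconn P fun i j hij => hP i j hij.extend
  have hlower := exists_le_card_support_combination hKL h
  rcases Nat.eq_or_lt_of_le ht with rfl | ht1
  · have := IsCoveringFamily.existsCovCode
      (⟨hh.exists_combination hKL, hlower⟩ : IsCoveringFamily L (extendVec L h) R)
    simpa using this
  · obtain ⟨m, rfl⟩ : ∃ m, t = m + 1 := ⟨t - 1, by omega⟩
    obtain ⟨M, _, _, _, hM, hLM⟩ := exists_field_extension L (n := m) (by omega)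
    rw [add_tsub_cancel_right, ← hL, ← hM] at hcond ⊢
    obtain ⟨β⟩ := Function.Embedding.nonempty_of_card_le (hcond.resolve_left (by omega))
    have := (isCoveringFamily_concatVec (L := L) (R := R) (h := extendVec L h) β.injective
      (fun s => by
        obtain ⟨c, hc, hcR⟩ := hh.exists_combination hKL s
        obtain ⟨c', hc', hcR'⟩ := exists_combination_card_eq h4 hconn' (by omega) hι c hcR
        exact ⟨c', hc'.trans hc, hcR'⟩) hlower).existsCovCode
    have hr : Module.finrank L ((Fin (R + 1) → L) × (Fin R → M)) = R * (m + 1) + 1 := by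
      rw [Module.finrank_prod, Module.finrank_fin_fun, Module.finrank_pi_fintype]
      simp [hLM]
      ring
    rwa [Fintype.card_prod, hr] at this
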